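/- arXiv:2502.14498 — 2 statements merged into one kernel-verified Lean document; each statement's English description precedes it below -/
import Mathlib

section
/- Assume K ∈ L¹(ℝ) and ‖s_t‖_∞ ≤ c₁ for some c₁ > 0. Then for every 𝐡 ∈ (0,1]² and every φ ∈ L²(ℝ²), E(⟨Φ_{𝐡,t}(X;·), φ⟩²) ≤ c₁ ‖K‖₁⁴ ‖φ‖², where ⟨·,·⟩ and ‖·‖ are the L²(ℝ²) inner product and norm and ‖K‖₁ is the L¹(ℝ)-norm of K. (Proposition A.2, property (3).) -/
open MeasureTheory ProbabilityTheory Real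

/-- Scaled kernel `K_h(x) = (1/h) K(x/h)`. -/
noncomputable def Kh (K : ℝ → ℝ) (h x : ℝ) : ℝ := h⁻¹ * K (x / h)

/-- Product kernel `Q_𝐡(x,y) = K_{h₁}(x) K_{h₂}(y)`. -/
noncomputable def Qker (K : ℝ → ℝ) (h₁ h₂ x y : ℝ) : ℝ := Kh K h₁ x * Kh K h₂ y

/-- `Φ_{𝐡,t}(φ; x,y) = (T−t₀)⁻¹ ∫_{t₀}^T Q_𝐡(φ(s)−x, φ(s+t)−y) ds`. -/
noncomputable def PhiMap (K : ℝ → ℝ) (t₀ T t h₁ h₂ : ℝ) (φ : ℝ → ℝ) (z : ℝ × ℝ) : ℝ :=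
  (T - t₀)⁻¹ * ∫ s in t₀..T, Qker K h₁ h₂ (φ s - z.1) (φ (s + t) - z.2)

open scoped ENNReal in
lemma aux_cs {α : Type*} [MeasurableSpace α] (ν : Measure α) (f : α → ℝ≥0∞) (hf : Measurable f) :
    (∫⁻ x, f x ∂ν) ^ 2 ≤ ν Set.univ * ∫⁻ x, f x ^ 2 ∂ν := by
  have h := ENNReal.lintegral_mul_le_Lp_mul_Lq ν (p := 2) (q := 2) Real.HolderConjugate.two_two
    (f := fun _ => 1) (g := f) aemeasurable_const hf.aemeasurable
  have h2 := pow_le_pow_left' h 2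
  simp only [Pi.mul_apply, one_mul, ENNReal.one_rpow, lintegral_one, mul_pow] at h2
  refine h2.trans (le_of_eq ?_)
  have e : ∀ x : ℝ≥0∞, (x ^ (1 / (2:ℝ))) ^ 2 = x := by
    intro x
    rw [← ENNReal.rpow_natCast, ← ENNReal.rpow_mul]
    norm_num
  rw [e, e]
  simp

open scoped ENNReal in
lemma aux_cs2 {α : Type*} [MeasurableSpace α] (ν : Measure α) (q f : α → ℝ≥0∞)
    (hq : Measurable q) (hf : Measurable f) :
    (∫⁻ x, q x * f x ∂ν) ^ 2 ≤ (∫⁻ x, q x ∂ν) * ∫⁻ x, q x * f x ^ 2 ∂ν := by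
  have h := aux_cs (ν.withDensity q) f hf
  rw [lintegral_withDensity_eq_lintegral_mul _ hq hf,
    lintegral_withDensity_eq_lintegral_mul _ hq (hf.pow_const 2), withDensity_apply _ .univ] at h
  simpa using h

lemma aux_Kh (K : ℝ → ℝ) (hKint : Integrable K) (h : ℝ) (hh : 0 < h) :
    ∫⁻ x, ‖Kh K h x‖ₑ = ENNReal.ofReal (∫ x, |K x|) := by
  have hi : Integrable (Kh K h) := (hKint.comp_div hh.ne').const_mul _
  rw [← ofReal_integral_norm_eq_lintegral_enorm hi]
  congr 1
  simp only [Kh, norm_mul, Real.norm_eq_abs]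
  rw [integral_const_mul, MeasureTheory.Measure.integral_comp_div (fun x => |K x|) h]
  simp only [smul_eq_mul, ← mul_assoc, ← abs_mul]
  rw [inv_mul_cancel₀ hh.ne']; simp

lemma aux_Q (K : ℝ → ℝ) (hKmeas : Measurable K) (hKint : Integrable K) (h₁ h₂ : ℝ) (hh₁ : 0 < h₁)
    (hh₂ : 0 < h₂) :
    ∫⁻ u : ℝ × ℝ, ‖Qker K h₁ h₂ u.1 u.2‖ₑ = ENNReal.ofReal (∫ x, |K x|) ^ 2 := by
  have hm : ∀ h, Measurable (Kh K h) := by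
    intro h; unfold Kh; fun_prop
  simp only [Qker, enorm_mul]
  rw [Measure.volume_eq_prod, lintegral_prod_mul (f := fun x => ‖Kh K h₁ x‖ₑ)
    (g := fun x => ‖Kh K h₂ x‖ₑ) (hm _).enorm.aemeasurable (hm _).enorm.aemeasurable,
    aux_Kh K hKint _ hh₁, aux_Kh K hKint _ hh₂, sq]

open scoped ENNReal in
lemma aux_young (q g : ℝ × ℝ → ℝ≥0∞) (hq : Measurable q) (hg : Measurable g) :
    ∫⁻ w, (∫⁻ z, q (w - z) * g z) ^ 2 ≤ (∫⁻ u, q u) ^ 2 * ∫⁻ z, g z ^ 2 := by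
  calc ∫⁻ w, (∫⁻ z, q (w - z) * g z) ^ 2
      ≤ ∫⁻ w, (∫⁻ u, q u) * ∫⁻ z, q (w - z) * g z ^ 2 := by
        refine lintegral_mono fun w => ?_
        have := aux_cs2 volume (fun z => q (w - z)) g (by fun_prop) hg
        rwa [lintegral_sub_left_eq_self q w] at this
    _ = (∫⁻ u, q u) * ∫⁻ w, ∫⁻ z, q (w - z) * g z ^ 2 := by
        rw [lintegral_const_mul]
        exact Measurable.lintegral_prod_right' (f := fun p : (ℝ × ℝ) × (ℝ × ℝ) =>
          q (p.1 - p.2) * g p.2 ^ 2) (by fun_prop)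
    _ = (∫⁻ u, q u) * ∫⁻ z, ∫⁻ w, q (w - z) * g z ^ 2 := by
        rw [lintegral_lintegral_swap]
        exact Measurable.aemeasurable (by unfold Function.uncurry; fun_prop)
    _ = _ := by
        have : ∀ z, ∫⁻ w, q (w - z) * g z ^ 2 = (∫⁻ u, q u) * g z ^ 2 := by
          intro z
          rw [lintegral_mul_const _ (by fun_prop), lintegral_sub_right_eq_self q z]
        simp only [this]
        rw [lintegral_const_mul _ (by fun_prop), sq, mul_assoc]

/-- Proposition A.2, property (3).
For every `𝐡 ∈ (0,1]²` and `φ ∈ L²(ℝ²)`,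
`E(⟨Φ_{𝐡,t}(X;·), φ⟩²) ≤ c₁‖K‖₁⁴‖φ‖²`. -/
theorem Phi_test_function_bound
    {Ω : Type*} [MeasurableSpace Ω] (P : Measure Ω) [IsProbabilityMeasure P]
    (K : ℝ → ℝ) (hKmeas : Measurable K)
    (hKint : Integrable K (volume : Measure ℝ))
    (t₀ T t : ℝ) (ht₀ : 0 ≤ t₀) (htT : t₀ < T) (ht : t ∈ Set.Ioc 0 T)
    (X : Ω → ℝ → ℝ)
    (hXmeas : Measurable (fun q : Ω × ℝ => X q.1 q.2))
    (hXcont : ∀ ω, ContinuousOn (X ω) (Set.Icc 0 (2 * T)))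
    (pst : ℝ → ℝ → ℝ → ℝ)
    (hpstmeas : Measurable (fun q : ℝ × ℝ × ℝ => pst q.1 q.2.1 q.2.2))
    (hpstpos : ∀ s ξ ζ, 0 ≤ pst s ξ ζ)
    (hdensity : ∀ s ∈ Set.Icc t₀ T,
      P.map (fun ω => (X ω s, X ω (s + t))) =
        (volume : Measure (ℝ × ℝ)).withDensity
          (fun z => ENNReal.ofReal (pst s z.1 z.2)))
    (c₁ : ℝ) (hc₁ : 0 < c₁)
    (hstbdd : ∀ ξ ζ : ℝ, |(T - t₀)⁻¹ * ∫ s in t₀..T, pst s ξ ζ| ≤ c₁)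
    (h₁ h₂ : ℝ) (hh₁ : h₁ ∈ Set.Ioc (0 : ℝ) 1) (hh₂ : h₂ ∈ Set.Ioc (0 : ℝ) 1)
    (φ : ℝ × ℝ → ℝ) (hφ : MemLp φ 2 (volume : Measure (ℝ × ℝ))) :
    ∫ ω, (∫ z : ℝ × ℝ, PhiMap K t₀ T t h₁ h₂ (X ω) z * φ z) ^ 2 ∂P
      ≤ c₁ * (∫ x, |K x|) ^ 4 * ∫ z : ℝ × ℝ, φ z ^ 2 := by
  set μ : Measure ℝ := volume.restrict (Set.Ioc t₀ T) with hμ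
  set A : ENNReal := ENNReal.ofReal (T - t₀)⁻¹ with hA
  have hTpos : 0 < T - t₀ := sub_pos.2 htT
  have hμuniv : μ Set.univ = ENNReal.ofReal (T - t₀) := by simp [hμ]
  have hAμ : A * μ Set.univ = 1 := by
    rw [hμuniv, hA, ← ENNReal.ofReal_mul (by positivity), inv_mul_cancel₀ hTpos.ne']; simp
  have hXω : ∀ ω, Measurable (X ω) := fun ω => hXmeas.comp measurable_prodMk_left
  have hKhm : ∀ h, Measurable (Kh K h) := by
    intro h; unfold Kh; fun_prop
  obtain ⟨φ', hφ'm, hφ'⟩ : ∃ φ', Measurable φ' ∧ φ =ᵐ[volume] φ' :=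
    ⟨hφ.1.mk φ, hφ.1.stronglyMeasurable_mk.measurable, hφ.1.ae_eq_mk⟩
  set g : ℝ × ℝ → ENNReal := fun z => ‖φ' z‖ₑ with hg
  have hgm : Measurable g := hφ'm.enorm
  set q : ℝ × ℝ → ENNReal := fun u => ‖Qker K h₁ h₂ u.1 u.2‖ₑ with hq
  have hqm : Measurable q := by
    have h1 := hKhm h₁
    have h2 := hKhm h₂
    simp only [hq, Qker]; fun_prop
  set G : ℝ × ℝ → ENNReal := fun w => ∫⁻ z, q (w - z) * g z with hG
  have hGm : Measurable G :=
    Measurable.lintegral_prod_right' (f := fun p : (ℝ × ℝ) × (ℝ × ℝ) =>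
          q (p.1 - p.2) * g p.2) (by fun_prop)
  have hYm : Measurable (fun p : Ω × ℝ => (X p.1 p.2, X p.1 (p.2 + t))) :=
    hXmeas.prodMk (hXmeas.comp (measurable_fst.prodMk (measurable_snd.add_const t)))
  -- step 1
  have step1 : ∀ ω, ‖∫ z : ℝ × ℝ, PhiMap K t₀ T t h₁ h₂ (X ω) z * φ z‖ₑ
      ≤ A * ∫⁻ s, G (X ω s, X ω (s + t)) ∂μ := by
    intro ω
    have hX1 := hXω ω
    have hY : Measurable (fun s => (X ω s, X ω (s + t))) := by fun_prop
    calc _ ≤ ∫⁻ z : ℝ × ℝ, ‖PhiMap K t₀ T t h₁ h₂ (X ω) z * φ z‖ₑ :=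
          enorm_integral_le_lintegral_enorm _
      _ ≤ ∫⁻ z : ℝ × ℝ, A * ∫⁻ s, q ((X ω s, X ω (s + t)) - z) * g z ∂μ := by
          refine lintegral_mono_ae ?_
          filter_upwards [hφ'] with z hz
          rw [enorm_mul, hz, PhiMap, enorm_mul, lintegral_mul_const _ (by fun_prop), mul_assoc,
            Real.enorm_of_nonneg (inv_nonneg.2 hTpos.le), intervalIntegral.integral_of_le htT.le]
          gcongr
          exact enorm_integral_le_lintegral_enorm _
      _ = A * ∫⁻ z : ℝ × ℝ, ∫⁻ s, q ((X ω s, X ω (s + t)) - z) * g z ∂μ := by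
          rw [lintegral_const_mul' _ _ ENNReal.ofReal_ne_top]
      _ = _ := by
          rw [lintegral_lintegral_swap]
          exact Measurable.aemeasurable (by unfold Function.uncurry; fun_prop)
  have step2 : ∀ ω, ‖(∫ z : ℝ × ℝ, PhiMap K t₀ T t h₁ h₂ (X ω) z * φ z) ^ 2‖ₑ
      ≤ A * ∫⁻ s, G (X ω s, X ω (s + t)) ^ 2 ∂μ := by
    intro ω
    have hX1 := hXω ω
    rw [enorm_pow]
    calc _ ≤ (A * ∫⁻ s, G (X ω s, X ω (s + t)) ∂μ) ^ 2 := pow_le_pow_left' (step1 ω) 2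
      _ ≤ A ^ 2 * (μ Set.univ * ∫⁻ s, G (X ω s, X ω (s + t)) ^ 2 ∂μ) := by
          rw [mul_pow]
          gcongr
          exact aux_cs μ _ (by fun_prop)
      _ = (A * μ Set.univ) * (A * ∫⁻ s, G (X ω s, X ω (s + t)) ^ 2 ∂μ) := by ring
      _ = _ := by rw [hAμ, one_mul]
  have hpm : Measurable (fun p : ℝ × (ℝ × ℝ) => ENNReal.ofReal (pst p.1 p.2.1 p.2.2)) :=
    hpstmeas.ennreal_ofReal
  have hpms : ∀ s, Measurable (fun z : ℝ × ℝ => ENNReal.ofReal (pst s z.1 z.2)) :=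
    fun s => hpm.comp measurable_prodMk_left
  have hpmz : ∀ z : ℝ × ℝ, Measurable (fun s => ENNReal.ofReal (pst s z.1 z.2)) :=
    fun z => hpm.comp measurable_prodMk_right
  have hYs : ∀ s, Measurable (fun ω => (X ω s, X ω (s + t))) :=
    fun s => hYm.comp measurable_prodMk_right
  have dens : ∀ F : ℝ × ℝ → ENNReal, Measurable F →
      ∫⁻ s, ∫⁻ ω, F (X ω s, X ω (s + t)) ∂P ∂μ
        = ∫⁻ w, (∫⁻ s, ENNReal.ofReal (pst s w.1 w.2) ∂μ) * F w := by
    intro F hF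
    have : ∀ s ∈ Set.Ioc t₀ T, ∫⁻ ω, F (X ω s, X ω (s + t)) ∂P
        = ∫⁻ w, ENNReal.ofReal (pst s w.1 w.2) * F w := by
      intro s hs
      rw [← lintegral_map hF (hYs s), hdensity s (Set.Ioc_subset_Icc_self hs),
        lintegral_withDensity_eq_lintegral_mul _ (hpms s) hF]
      rfl
    rw [hμ, setLIntegral_congr_fun measurableSet_Ioc this, lintegral_lintegral_swap]
    · refine lintegral_congr fun w => ?_
      rw [lintegral_mul_const _ (hpmz w)]
    · exact (hpm.mul (hF.comp measurable_snd)).aemeasurable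
  have hbd : ∀ᵐ w : ℝ × ℝ, A * ∫⁻ s, ENNReal.ofReal (pst s w.1 w.2) ∂μ ≤ ENNReal.ofReal c₁ := by
    have h1 := dens (fun _ => 1) measurable_const
    simp only [mul_one, lintegral_one, measure_univ] at h1
    have hfin : ∀ᵐ w : ℝ × ℝ, ∫⁻ s, ENNReal.ofReal (pst s w.1 w.2) ∂μ < ⊤ := by
      refine ae_lt_top (Measurable.lintegral_prod_left' hpm) ?_
      rw [← h1, hμuniv]
      exact ENNReal.ofReal_ne_top
    filter_upwards [hfin] with w hw
    have hi : Integrable (fun s => pst s w.1 w.2) μ := by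
      refine ⟨(hpstmeas.comp (measurable_prodMk_right (y := w))).aestronglyMeasurable, ?_⟩
      rw [hasFiniteIntegral_iff_ofReal (ae_of_all _ fun s => hpstpos _ _ _)]
      exact hw
    rw [← ofReal_integral_eq_lintegral_ofReal hi (ae_of_all _ fun s => hpstpos _ _ _), hA,
      ← ENNReal.ofReal_mul (inv_nonneg.2 hTpos.le)]
    apply ENNReal.ofReal_le_ofReal
    have := hstbdd w.1 w.2
    rw [intervalIntegral.integral_of_le htT.le] at this
    exact (le_abs_self _).trans this
  have hgsq : ∫⁻ z, g z ^ 2 = ENNReal.ofReal (∫ z, φ z ^ 2) := by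
    rw [ofReal_integral_eq_lintegral_ofReal hφ.integrable_sq (ae_of_all _ fun z => sq_nonneg _)]
    refine lintegral_congr_ae ?_
    filter_upwards [hφ'] with z hz
    rw [hg, hz, ← enorm_pow, Real.enorm_of_nonneg (sq_nonneg _)]
  have hI : 0 ≤ ∫ x, |K x| := integral_nonneg fun x => abs_nonneg _
  have hI2 : 0 ≤ ∫ z : ℝ × ℝ, φ z ^ 2 := integral_nonneg fun x => sq_nonneg _
  have key : ‖∫ ω, (∫ z : ℝ × ℝ, PhiMap K t₀ T t h₁ h₂ (X ω) z * φ z) ^ 2 ∂P‖ₑ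
      ≤ ENNReal.ofReal (c₁ * (∫ x, |K x|) ^ 4 * ∫ z : ℝ × ℝ, φ z ^ 2) := by
    calc _ ≤ ∫⁻ ω, ‖(∫ z : ℝ × ℝ, PhiMap K t₀ T t h₁ h₂ (X ω) z * φ z) ^ 2‖ₑ ∂P :=
          enorm_integral_le_lintegral_enorm _
      _ ≤ ∫⁻ ω, A * ∫⁻ s, G (X ω s, X ω (s + t)) ^ 2 ∂μ ∂P := lintegral_mono step2
      _ = A * ∫⁻ ω, ∫⁻ s, G (X ω s, X ω (s + t)) ^ 2 ∂μ ∂P := by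
          rw [lintegral_const_mul' _ _ ENNReal.ofReal_ne_top]
      _ = A * ∫⁻ s, ∫⁻ ω, G (X ω s, X ω (s + t)) ^ 2 ∂P ∂μ := by
          rw [lintegral_lintegral_swap]
          exact ((hGm.comp hYm).pow_const 2).aemeasurable
      _ = ∫⁻ w, (A * ∫⁻ s, ENNReal.ofReal (pst s w.1 w.2) ∂μ) * G w ^ 2 := by
          rw [dens (fun w => G w ^ 2) (hGm.pow_const 2),
            ← lintegral_const_mul' _ _ ENNReal.ofReal_ne_top]
          simp only [mul_assoc, hA]
      _ ≤ ∫⁻ w, ENNReal.ofReal c₁ * G w ^ 2 := by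
          refine lintegral_mono_ae ?_
          filter_upwards [hbd] with w hw
          gcongr
      _ = ENNReal.ofReal c₁ * ∫⁻ w, G w ^ 2 := by
          rw [lintegral_const_mul' _ _ ENNReal.ofReal_ne_top]
      _ ≤ ENNReal.ofReal c₁ * ((∫⁻ u, q u) ^ 2 * ∫⁻ z, g z ^ 2) := by
          gcongr
          exact aux_young q g hqm hgm
      _ = _ := by
          rw [hgsq, hq, aux_Q K hKmeas hKint h₁ h₂ hh₁.1 hh₂.1,
            ENNReal.ofReal_mul (by positivity), ENNReal.ofReal_mul hc₁.le, ENNReal.ofReal_pow hI]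
          ring
  rw [Real.enorm_of_nonneg (integral_nonneg fun ω => sq_nonneg _)] at key
  exact (ENNReal.ofReal_le_ofReal_iff (by positivity)).1 key
end

section
/- Assume t₀ > 0, K is a square-integrable, symmetric, integrable kernel function, and sup_{t∈[t₀,T]} ‖s_t‖_∞ ≤ c₁ < ∞ with s_t ∈ L²(ℝ²) for all t ∈ [t₀,T]. Then there exists a deterministic constant c > 0, not depending on N, t, H_N, θ and λ (but possibly on t₀, T, K, c₁ and the law of X), such that: for every N ∈ ℕ*, every finite H_N ⊂ [h₀,1] with N h₀ ≥ 1, every t ∈ [t₀,T], every θ ∈ (0,1) and every λ > 0, with probability at least 1 − 2|H_N|² e^{−λ}, the following three bounds hold simultaneously: sup_{𝐡∈H_N²}{ |W_{𝐡,𝐡₀}| − θ‖s_{𝐡₀,t} − s_t‖² } ≤ c(1+λ)²/(θN), sup_{𝐡∈H_N²}{ |W_{𝐡₀,𝐡}| − θ‖s_{𝐡,t} − s_t‖² } ≤ c(1+λ)²/(θN), and sup_{𝐡∈H_N²}{ |W_{𝐡,𝐡}| − θ‖s_{𝐡,t} − s_t‖² } ≤ c(1+λ)²/(θN), where W_{𝐡,𝐥}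 := ⟨ŝ_{𝐡,t} − s_{𝐡,t}, s_{𝐥,t} − s_t⟩ and 𝐡₀ := (h₀,h₀). (Lemma A.5.) -/
open MeasureTheory ProbabilityTheory Real

/-- The smoothed target `s_{𝐡,t} = Q_𝐡 ⋆ s_t` (convolution on `ℝ²`). -/
noncomputable def sConv (K : ℝ → ℝ) (h₁ h₂ : ℝ) (st : ℝ × ℝ → ℝ) (z : ℝ × ℝ) : ℝ :=
  ∫ w : ℝ × ℝ, Qker K h₁ h₂ (z.1 - w.1) (z.2 - w.2) * st w

/-- The estimator `ŝ_{𝐡,t} = N⁻¹ Σ_i Φ_{𝐡,t}(Xⁱ;·)`. -/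
noncomputable def sHat {Ω : Type*} (K : ℝ → ℝ) (t₀ T t : ℝ) (X : ℕ → Ω → ℝ → ℝ)
    (N : ℕ) (h₁ h₂ : ℝ) (ω : Ω) (z : ℝ × ℝ) : ℝ :=
  (N : ℝ)⁻¹ * ∑ i ∈ Finset.range N, PhiMap K t₀ T t h₁ h₂ (X i ω) z


/-- `W_{𝐡,𝐥} = ⟨ŝ_{𝐡,t} − s_{𝐡,t}, s_{𝐥,t} − s_t⟩`. -/
noncomputable def Wstat {Ω : Type*} (K : ℝ → ℝ) (t₀ T t : ℝ) (st : ℝ × ℝ → ℝ)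
    (X : ℕ → Ω → ℝ → ℝ) (N : ℕ) (bh bl : ℝ × ℝ) (ω : Ω) : ℝ :=
  ∫ z : ℝ × ℝ, (sHat K t₀ T t X N bh.1 bh.2 ω z - sConv K bh.1 bh.2 st z) *
    (sConv K bl.1 bl.2 st z - st z)

/-- The squared bias `‖s_{𝐡,t} − s_t‖²`. -/
noncomputable def biasSq (K : ℝ → ℝ) (st : ℝ × ℝ → ℝ) (bh : ℝ × ℝ) : ℝ :=
  ∫ z : ℝ × ℝ, (sConv K bh.1 bh.2 st z - st z) ^ 2


lemma integral_comb3 {α : Type*} [MeasurableSpace α] {μ : Measure α} {f g h : α → ℝ}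
    (hf : Integrable f μ) (hg : Integrable g μ) (hh : Integrable h μ) (a b c : ℝ) :
    ∫ x, (a * f x + b * g x + c * h x) ∂μ = a * ∫ x, f x ∂μ + b * ∫ x, g x ∂μ + c * ∫ x, h x ∂μ := by
  have h1 : Integrable (fun x => a * f x + b * g x) μ := (hf.const_mul a).add (hg.const_mul b)
  rw [integral_add h1 (hh.const_mul c), integral_add (hf.const_mul a) (hg.const_mul b),
    integral_const_mul, integral_const_mul, integral_const_mul]

noncomputable def cv (q f : ℝ × ℝ → ℝ) (z : ℝ × ℝ) : ℝ := ∫ w, q (z - w) * f w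

lemma cv_fiber_int {q f : ℝ × ℝ → ℝ} {M : ℝ} (hqi : Integrable q)
    (hf : Measurable f) (hM : ∀ z, |f z| ≤ M) (z : ℝ × ℝ) :
    Integrable (fun w => q (z - w) * f w) :=
  (hqi.comp_sub_left z).mul_bdd hf.aestronglyMeasurable (Filter.Eventually.of_forall hM)

lemma cv_bdd {q f : ℝ × ℝ → ℝ} {M : ℝ} (hqi : Integrable q)
    (hM : ∀ z, |f z| ≤ M) (z : ℝ × ℝ) :
    |cv q f z| ≤ (∫ w, |q w|) * M := by
  have h1 : Integrable (fun w => |q (z - w)| * M) := ((hqi.comp_sub_left z).abs).mul_const M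
  have := norm_integral_le_of_norm_le (f := fun w => q (z - w) * f w) h1
    (Filter.Eventually.of_forall fun w => by
      rw [Real.norm_eq_abs, abs_mul]
      exact mul_le_mul_of_nonneg_left (hM w) (abs_nonneg _))
  rw [integral_mul_const, integral_sub_left_eq_self (fun w => |q w|)] at this
  exact this

lemma cv_meas {q f : ℝ × ℝ → ℝ} (hq : Measurable q) (hf : Measurable f) : Measurable (cv q f) := by
  have : Measurable (Function.uncurry fun z w : ℝ × ℝ => q (z - w) * f w) :=
    (hq.comp (measurable_fst.sub measurable_snd)).mul (hf.comp measurable_snd)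
  exact (this.stronglyMeasurable.integral_prod_right).measurable

lemma cv_joint {q f : ℝ × ℝ → ℝ} (hqi : Integrable q) (hfi : Integrable f) :
    Integrable (fun p : (ℝ × ℝ) × (ℝ × ℝ) => q (p.1 - p.2) * f p.2) (volume.prod volume) := by
  have := hfi.convolution_integrand (ContinuousLinearMap.mul ℝ ℝ) hqi
  refine this.congr (Filter.Eventually.of_forall fun p => ?_)
  simp [mul_comm]

lemma cv_int {q f : ℝ × ℝ → ℝ} (hqi : Integrable q) (hfi : Integrable f) : Integrable (cv q f) :=
  (cv_joint hqi hfi).integral_prod_left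

lemma cv_integral {q f : ℝ × ℝ → ℝ} (hqi : Integrable q) (hfi : Integrable f) :
    ∫ z, cv q f z = (∫ z, q z) * ∫ z, f z := by
  unfold cv
  rw [integral_integral_swap (f := fun z w : ℝ × ℝ => q (z - w) * f w) (cv_joint hqi hfi)]
  simp_rw [integral_mul_const, integral_sub_right_eq_self (fun w => q w), integral_const_mul]

lemma cv_dual {q f g : ℝ × ℝ → ℝ} {M : ℝ} (hqi : Integrable q) (hqs : ∀ z, q (-z) = q z)
    (hfi : Integrable f) (hg : Measurable g) (hM : ∀ z, |g z| ≤ M) :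
    ∫ z, cv q f z * g z = ∫ w, cv q g w * f w := by
  have hI : Integrable (Function.uncurry fun z w : ℝ × ℝ => q (z - w) * f w * g z)
      (volume.prod volume) :=
    (cv_joint hqi hfi).mul_bdd (hg.comp measurable_fst).aestronglyMeasurable
      (Filter.Eventually.of_forall fun p => hM p.1)
  calc ∫ z, cv q f z * g z = ∫ z, ∫ w, q (z - w) * f w * g z := by
        simp_rw [integral_mul_const]; rfl
    _ = ∫ w, ∫ z, q (z - w) * f w * g z := integral_integral_swap hI
    _ = ∫ w, ∫ z, q (w - z) * g z * f w := by
        congr 1; ext w; congr 1; ext z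
        rw [← hqs (z - w), neg_sub]; ring
    _ = _ := by simp_rw [integral_mul_const]; rfl

lemma cv_sq {q f : ℝ × ℝ → ℝ} {M : ℝ} (hqi : Integrable q) (hA : 0 < ∫ w, |q w|)
    (hf : Measurable f) (hM : ∀ z, |f z| ≤ M) (z : ℝ × ℝ) :
    (cv q f z) ^ 2 ≤ (∫ w, |q w|) * cv (fun w => |q w|) (fun w => f w ^ 2) z := by
  set A := ∫ w, |q w| with hAdef
  set J := cv (fun w => |q w|) (fun w => f w ^ 2) z with hJ
  set I := cv (fun w => |q w|) (fun w => |f w|) z with hI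
  have i1 : Integrable (fun w => |q (z - w)|) := (hqi.comp_sub_left z).abs
  have i2 : Integrable (fun w => |q (z - w)| * |f w|) :=
    cv_fiber_int (q := fun w => |q w|) (f := fun w => |f w|) (M := M) hqi.abs hf.abs
      (fun z => by simpa using hM z) z
  have i3 : Integrable (fun w => |q (z - w)| * f w ^ 2) :=
    cv_fiber_int (q := fun w => |q w|) (f := fun w => f w ^ 2) (M := M ^ 2) hqi.abs (hf.pow_const 2)
      (fun z => by
        rw [abs_pow]; exact pow_le_pow_left₀ (abs_nonneg _) (hM z) 2) z
  have hA' : ∫ w, |q (z - w)| = A := integral_sub_left_eq_self (fun w => |q w|) _ _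
  have e : ∫ w, |q (z - w)| * (A * |f w| - I) ^ 2 = A ^ 2 * J - 2 * A * I * I + I ^ 2 * A := by
    have := integral_comb3 i3 i2 i1 (A ^ 2) (-(2 * A * I)) (I ^ 2)
    rw [hA'] at this
    have e2 : (∫ w, |q (z - w)| * f w ^ 2) = J := rfl
    have e3 : (∫ w, |q (z - w)| * |f w|) = I := rfl
    rw [e2, e3] at this
    rw [sub_eq_add_neg, ← neg_mul, ← this]
    congr 1; ext w; rw [← sq_abs (f w)]; ring
  have e0 : 0 ≤ ∫ w, |q (z - w)| * (A * |f w| - I) ^ 2 :=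
    integral_nonneg fun w => by positivity
  have hle : |cv q f z| ≤ I := by
    have := norm_integral_le_of_norm_le (f := fun w => q (z - w) * f w) i2
      (Filter.Eventually.of_forall fun w => by
        rw [Real.norm_eq_abs, abs_mul])
    exact this
  have h1 : (cv q f z) ^ 2 ≤ I ^ 2 := by
    rw [← sq_abs]; exact pow_le_pow_left₀ (abs_nonneg _) hle 2
  have h2 : I ^ 2 ≤ A * J := by
    rw [e] at e0
    have : 0 ≤ A * (A * J - I ^ 2) := by linarith
    have := nonneg_of_mul_nonneg_right this hA
    linarith
  exact h1.trans h2

lemma cv_sq_int {q f : ℝ × ℝ → ℝ} {M : ℝ} (hq : Measurable q) (hqi : Integrable q)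
    (hA : 0 < ∫ w, |q w|) (hf : Measurable f) (hM : ∀ z, |f z| ≤ M)
    (hf2 : Integrable (fun w => f w ^ 2)) :
    Integrable (fun z => cv q f z ^ 2) ∧
      ∫ z, cv q f z ^ 2 ≤ (∫ w, |q w|) ^ 2 * ∫ w, f w ^ 2 := by
  have h := (cv_int hqi.abs hf2).const_mul (∫ w, |q w|)
  have hI : Integrable (fun z => cv q f z ^ 2) := by
    refine h.mono' ((cv_meas hq hf).pow_const 2).aestronglyMeasurable
      (Filter.Eventually.of_forall fun z => ?_)
    rw [Real.norm_eq_abs, abs_of_nonneg (sq_nonneg _)]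
    exact cv_sq hqi hA hf hM z
  refine ⟨hI, ?_⟩
  refine (integral_mono hI h fun z => cv_sq hqi hA hf hM z).trans ?_
  rw [integral_const_mul, cv_integral hqi.abs hf2]
  exact le_of_eq (by ring)

/-- Fubini along a path. -/
lemma path_fubini {q g : ℝ × ℝ → ℝ} {M : ℝ} (hq : Measurable q) (hqi : Integrable q)
    (hg : Measurable g) (hM : ∀ z, |g z| ≤ M) (ν : Measure ℝ) [IsFiniteMeasure ν]
    (ψ : ℝ → ℝ × ℝ) (hψ : Measurable ψ) :
    Integrable (fun z => (∫ s, q (ψ s - z) ∂ν)) ∧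
    ∫ z, (∫ s, q (ψ s - z) ∂ν) * g z = ∫ s, cv q g (ψ s) ∂ν := by
  have hm : Measurable (fun p : ℝ × (ℝ × ℝ) => q (ψ p.1 - p.2)) :=
    hq.comp ((hψ.comp measurable_fst).sub measurable_snd)
  have hI : Integrable (fun p : ℝ × (ℝ × ℝ) => q (ψ p.1 - p.2)) (ν.prod volume) := by
    rw [integrable_prod_iff hm.aestronglyMeasurable]
    refine ⟨Filter.Eventually.of_forall fun s => hqi.comp_sub_left (ψ s), ?_⟩
    have : (fun s => ∫ z, ‖q (ψ s - z)‖) = fun _ => ∫ z, ‖q z‖ := by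
      ext s; exact integral_sub_left_eq_self (fun z => ‖q z‖) _ _
    simp only [this]
    exact integrable_const _
  refine ⟨hI.integral_prod_right, ?_⟩
  have hI2 : Integrable (Function.uncurry fun (s : ℝ) (z : ℝ × ℝ) => q (ψ s - z) * g z)
      (ν.prod volume) :=
    hI.mul_bdd (hg.comp measurable_snd).aestronglyMeasurable
      (Filter.Eventually.of_forall fun p => hM p.2)
  unfold cv
  rw [integral_integral_swap hI2]
  simp_rw [integral_mul_const]

lemma Kh_int {K : ℝ → ℝ} (hK : Integrable K) {h : ℝ} (hh : 0 < h) :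
    Integrable (Kh K h) ∧ ∫ x, |Kh K h x| = ∫ x, |K x| := by
  constructor
  · exact (hK.comp_div hh.ne').const_mul _
  · unfold Kh
    simp_rw [abs_mul, integral_const_mul]
    rw [Measure.integral_comp_div (fun x => |K x|) h, abs_of_pos (inv_pos.2 hh), abs_of_pos hh,
      smul_eq_mul, inv_mul_cancel_left₀ hh.ne']

noncomputable def Qp (K : ℝ → ℝ) (h : ℝ × ℝ) (z : ℝ × ℝ) : ℝ := Qker K h.1 h.2 z.1 z.2

lemma Qp_meas {K : ℝ → ℝ} (hK : Measurable K) (h : ℝ × ℝ) : Measurable (Qp K h) := by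
  unfold Qp Qker Kh
  fun_prop

lemma Qp_int {K : ℝ → ℝ} (hK : Integrable K) {h : ℝ × ℝ} (h1 : 0 < h.1) (h2 : 0 < h.2) :
    Integrable (Qp K h) ∧ ∫ x, |Qp K h x| = (∫ x, |K x|) ^ 2 := by
  constructor
  · exact (Kh_int hK h1).1.mul_prod (Kh_int hK h2).1
  · unfold Qp Qker
    simp_rw [abs_mul]
    rw [Measure.volume_eq_prod, integral_prod_mul (fun x => |Kh K h.1 x|) (fun x => |Kh K h.2 x|),
      (Kh_int hK h1).2, (Kh_int hK h2).2, sq]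

lemma Qp_even {K : ℝ → ℝ} (hK : ∀ x, K (-x) = K x) (h z : ℝ × ℝ) : Qp K h (-z) = Qp K h z := by
  simp [Qp, Qker, Kh, neg_div, hK]

lemma mgf_bern {Ω : Type*} [MeasurableSpace Ω] (P : Measure Ω) [IsProbabilityMeasure P]
    (Z : Ω → ℝ) (hZ : Measurable Z) (b v u : ℝ) (hb : ∀ ω, |Z ω| ≤ b) (h0 : ∫ ω, Z ω ∂P = 0)
    (h2 : ∫ ω, Z ω ^ 2 ∂P ≤ v) (hu : |u| * b ≤ 1) : mgf Z P u ≤ exp (u ^ 2 * v) := by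
  have hZi : Integrable Z P := Integrable.of_bound hZ.aestronglyMeasurable b
    (Filter.Eventually.of_forall hb)
  have hZ2 : Integrable (fun ω => Z ω ^ 2) P :=
    Integrable.of_bound (hZ.pow_const 2).aestronglyMeasurable (b ^ 2)
      (Filter.Eventually.of_forall fun ω => by
        rw [norm_pow]; exact pow_le_pow_left₀ (norm_nonneg _) (hb ω) 2)
  have hle : ∀ ω, |u * Z ω| ≤ 1 := fun ω => by
    rw [abs_mul]
    exact (mul_le_mul_of_nonneg_left (hb ω) (abs_nonneg _)).trans hu
  have hpt : ∀ ω, exp (u * Z ω) ≤ 1 + u * Z ω + u ^ 2 * Z ω ^ 2 := fun ω => by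
    have := (abs_le.1 (Real.abs_exp_sub_one_sub_id_le (hle ω))).2
    nlinarith
  have hE : Integrable (fun ω => exp (u * Z ω)) P :=
    Integrable.of_bound (by fun_prop) (exp 1)
      (Filter.Eventually.of_forall fun ω => by
        rw [Real.norm_eq_abs, abs_exp]
        exact exp_le_exp.2 ((le_abs_self _).trans (hle ω)))
  calc mgf Z P u ≤ ∫ ω, (1 + u * Z ω + u ^ 2 * Z ω ^ 2) ∂P :=
        integral_mono hE (((integrable_const _).add (hZi.const_mul _)).add (hZ2.const_mul _)) hpt
    _ = 1 + u ^ 2 * ∫ ω, Z ω ^ 2 ∂P := by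
        have := integral_comb3 (integrable_const (μ := P) (1 : ℝ)) hZi hZ2 1 u (u ^ 2)
        simp only [mul_one] at this
        rw [this, h0]; simp
    _ ≤ u ^ 2 * v + 1 := by nlinarith [sq_nonneg u]
    _ ≤ _ := add_one_le_exp _

lemma bern_one {Ω : Type*} [MeasurableSpace Ω] (P : Measure Ω) [IsProbabilityMeasure P]
    (Z : ℕ → Ω → ℝ) (hZ : ∀ i, Measurable (Z i)) (hind : iIndepFun Z P) (b v u a l : ℝ)
    (hb : ∀ i ω, |Z i ω| ≤ b) (h0 : ∀ i, ∫ ω, Z i ω ∂P = 0)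
    (h2 : ∀ i, ∫ ω, Z i ω ^ 2 ∂P ≤ v) (hu0 : 0 < u) (hu : u * b ≤ 1) (N : ℕ) 
    (ha : N * (u ^ 2 * v) + l ≤ u * a) :
    P.real {ω | a ≤ ∑ i ∈ Finset.range N, Z i ω} ≤ exp (-l) := by
  have hS : ∀ ω, (∑ i ∈ Finset.range N, Z i) ω = ∑ i ∈ Finset.range N, Z i ω := fun ω => by simp
  have hm : Measurable (∑ i ∈ Finset.range N, Z i) := by
    have := Finset.measurable_sum (Finset.range N) fun i _ => hZ i
    convert this using 1
    ext ω; simp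
  have hint : Integrable (fun ω => exp (u * (∑ i ∈ Finset.range N, Z i) ω)) P :=
    Integrable.of_bound (by fun_prop) (exp (u * (N * b)))
      (Filter.Eventually.of_forall fun ω => by
        rw [Real.norm_eq_abs, abs_exp]
        refine exp_le_exp.2 (mul_le_mul_of_nonneg_left ?_ hu0.le)
        rw [hS]
        refine (Finset.sum_le_sum fun i _ => (le_abs_self _).trans (hb i ω)).trans ?_
        simp)
  have := measure_ge_le_exp_mul_mgf (μ := P) a hu0.le hint
  rw [hind.mgf_sum hZ] at this
  simp only [hS] at this
  refine this.trans ?_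
  have hp : ∏ i ∈ Finset.range N, mgf (Z i) P u ≤ exp (N * (u ^ 2 * v)) := by
    rw [Real.exp_nat_mul]
    refine (Finset.prod_le_prod (fun i _ => mgf_nonneg) fun i _ =>
      mgf_bern P (Z i) (hZ i) b v u (hb i) (h0 i) (h2 i) (by rwa [abs_of_pos hu0])).trans ?_
    simp
  refine (mul_le_mul_of_nonneg_left hp (exp_pos _).le).trans ?_
  rw [← exp_add]
  exact exp_le_exp.2 (by linarith)

lemma bern {Ω : Type*} [MeasurableSpace Ω] (P : Measure Ω) [IsProbabilityMeasure P]
    (Y : ℕ → Ω → ℝ) (hY : ∀ i, Measurable (Y i)) (hind : iIndepFun Y P) (m B v u a l : ℝ)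
    (hb : ∀ i ω, |Y i ω| ≤ B) (h0 : ∀ i, ∫ ω, Y i ω ∂P = m)
    (h2 : ∀ i, ∫ ω, Y i ω ^ 2 ∂P ≤ v) (hu0 : 0 < u) (hu : u * (2 * B) ≤ 1) (N : ℕ) (hN : 0 < N)
    (ha : u * v + l / (u * N) ≤ a) :
    P.real {ω | a ≤ |(N : ℝ)⁻¹ * ∑ i ∈ Finset.range N, Y i ω - m|} ≤ 2 * exp (-l) := by
  have hN' : (0 : ℝ) < N := by exact_mod_cast hN
  have hYi : ∀ i, Integrable (Y i) P := fun i => Integrable.of_bound (hY i).aestronglyMeasurable B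
    (Filter.Eventually.of_forall (hb i))
  have hY2 : ∀ i, Integrable (fun ω => Y i ω ^ 2) P := fun i =>
    Integrable.of_bound ((hY i).pow_const 2).aestronglyMeasurable (B ^ 2)
      (Filter.Eventually.of_forall fun ω => by
        rw [norm_pow]; exact pow_le_pow_left₀ (norm_nonneg _) (hb i ω) 2)
  have hmB : |m| ≤ B := by
    rw [← h0 0]
    have := norm_integral_le_of_norm_le (μ := P) (f := Y 0) (integrable_const B)
      (Filter.Eventually.of_forall (hb 0))
    simpa using this
  have hvar : ∀ i, ∫ ω, (Y i ω - m) ^ 2 ∂P ≤ v := fun i => by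
    have := integral_comb3 (hY2 i) (hYi i) (integrable_const (μ := P) (1 : ℝ)) 1 (-(2 * m)) (m ^ 2)
    rw [h0 i] at this
    have e : ∫ ω, (Y i ω - m) ^ 2 ∂P =
        ∫ ω, (1 * Y i ω ^ 2 + -(2 * m) * Y i ω + m ^ 2 * 1) ∂P := by
      congr 1; ext ω; ring
    rw [e, this]
    simp only [integral_const, probReal_univ, smul_eq_mul]
    nlinarith [h2 i, sq_nonneg m]
  have hcond : N * (u ^ 2 * v) + l ≤ u * (N * a) := by
    have := mul_le_mul_of_nonneg_left ha (mul_pos hu0 hN').le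
    rw [mul_add, mul_div_cancel₀ _ (mul_pos hu0 hN').ne'] at this
    nlinarith
  have key1 := bern_one P (fun i ω => Y i ω - m) (fun i => (hY i).sub_const m)
    (hind.comp (fun _ x => x - m) (fun _ => by fun_prop)) (2 * B) v u (N * a) l
    (fun i ω => (abs_sub _ _).trans (by linarith [hb i ω]))
    (fun i => by rw [integral_sub (hYi i) (integrable_const _), h0 i]; simp) hvar hu0 hu N hcond
  have key2 := bern_one P (fun i ω => m - Y i ω) (fun i => (hY i).const_sub m)
    (hind.comp (fun _ x => m - x) (fun _ => by fun_prop)) (2 * B) v u (N * a) l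
    (fun i ω => (abs_sub _ _).trans (by linarith [hb i ω]))
    (fun i => by rw [integral_sub (integrable_const _) (hYi i), h0 i]; simp)
    (fun i => by
      refine le_trans (le_of_eq ?_) (hvar i)
      congr 1; ext ω; ring) hu0 hu N hcond
  have hsub : {ω | a ≤ |(N : ℝ)⁻¹ * ∑ i ∈ Finset.range N, Y i ω - m|} ⊆
      {ω | N * a ≤ ∑ i ∈ Finset.range N, (Y i ω - m)} ∪
      {ω | N * a ≤ ∑ i ∈ Finset.range N, (m - Y i ω)} := by
    intro ω hω
    simp only [Set.mem_ofPred_eq, Set.mem_union, Finset.sum_sub_distrib, Finset.sum_const,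
      Finset.card_range, nsmul_eq_mul] at hω ⊢
    have e : (N : ℝ) * ((N : ℝ)⁻¹ * ∑ i ∈ Finset.range N, Y i ω - m)
        = ∑ i ∈ Finset.range N, Y i ω - N * m := by
      rw [mul_sub, mul_inv_cancel_left₀ hN'.ne']
    rcases le_abs.1 hω with h | h
    · left; have := mul_le_mul_of_nonneg_left h hN'.le; linarith
    · right; have := mul_le_mul_of_nonneg_left h hN'.le; linarith
  calc _ ≤ _ := measureReal_mono hsub
    _ ≤ _ := measureReal_union_le _ _
    _ ≤ _ := by linarith

lemma path_meas {Ω : Type*} (X : Ω → ℝ → ℝ) (t₀ T t : ℝ) (ht₀ : 0 < t₀) (htT : t₀ < T)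
    (ht : t ∈ Set.Icc t₀ T)
    (hc : ∀ ω, ContinuousOn (X ω) (Set.Icc 0 (2 * T))) (G : ℝ × ℝ → ℝ) (hG : Measurable G) :
    ∃ F : (ℝ → ℝ) → ℝ, Measurable F ∧
      (fun ω => ∫ s in t₀..T, G (X ω s, X ω (s + t))) = F ∘ X := by
  let mX : MeasurableSpace Ω := MeasurableSpace.comap X inferInstance
  refine Measurable.exists_eq_measurable_comp (f := X) ?_
  have hX : Measurable X := comap_measurable X
  have h2T : (0 : ℝ) ≤ 2 * T := by linarith
  let Z : ℝ → Ω → ℝ := fun s ω => X ω (Set.projIcc 0 (2 * T) h2T s)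
  have hZ : Measurable (Function.uncurry Z) := by
    refine measurable_uncurry_of_continuous_of_measurable (fun ω => ?_) (fun s => ?_)
    · exact (hc ω).comp_continuous (continuous_subtype_val.comp continuous_projIcc)
        (fun s => (Set.projIcc 0 (2 * T) h2T s).2)
    · exact (measurable_pi_apply _).comp hX
  have e : (fun ω => ∫ s in t₀..T, G (X ω s, X ω (s + t)))
      = fun ω => ∫ s in t₀..T, G (Z s ω, Z (s + t) ω) := by
    ext ω
    refine intervalIntegral.integral_congr fun s hs => ?_
    rw [Set.uIcc_of_le htT.le] at hs
    have h1 : s ∈ Set.Icc 0 (2 * T) := ⟨by linarith [hs.1], by linarith [hs.2]⟩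
    have h2 : s + t ∈ Set.Icc 0 (2 * T) := ⟨by linarith [hs.1, ht.1], by linarith [hs.2, ht.2]⟩
    simp only [Z, Set.projIcc_of_mem h2T h1, Set.projIcc_of_mem h2T h2]
  rw [e]
  simp_rw [intervalIntegral.integral_of_le htT.le]
  have hm : Measurable (Function.uncurry fun (ω : Ω) (s : ℝ) => G (Z s ω, Z (s + t) ω)) := by
    refine hG.comp (Measurable.prodMk ?_ ?_)
    · exact hZ.comp (measurable_snd.prodMk measurable_fst)
    · exact hZ.comp ((measurable_snd.add_const t).prodMk measurable_fst)
  exact (hm.stronglyMeasurable.integral_prod_right).measurable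

lemma dens_joint {Ω : Type*} [MeasurableSpace Ω] (P : Measure Ω) [IsProbabilityMeasure P]
    (X : Ω → ℝ → ℝ) (hX : Measurable (fun q : Ω × ℝ => X q.1 q.2)) (t₀ T t : ℝ)
    (p : ℝ → ℝ → ℝ → ℝ) (hp : Measurable (fun q : ℝ × ℝ × ℝ => p q.1 q.2.1 q.2.2))
    (hp0 : ∀ s x y, 0 ≤ p s x y)
    (hd : ∀ s ∈ Set.Icc t₀ T, P.map (fun ω => (X ω s, X ω (s + t))) =
        (volume : Measure (ℝ × ℝ)).withDensity (fun z => ENNReal.ofReal (p s z.1 z.2))) :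
    Integrable (fun q : ℝ × ℝ × ℝ => p q.1 q.2.1 q.2.2)
      ((volume.restrict (Set.Ioc t₀ T)).prod volume) := by
  have hXs : ∀ s, Measurable fun ω => X ω s := fun s => hX.comp (measurable_id.prodMk measurable_const)
  have hps : ∀ s, Measurable fun z : ℝ × ℝ => p s z.1 z.2 := fun s =>
    hp.comp (measurable_const.prodMk measurable_id)
  have hl : ∀ s ∈ Set.Icc t₀ T, ∫⁻ z : ℝ × ℝ, ENNReal.ofReal (p s z.1 z.2) = 1 := by
    intro s hs
    have h1 : P.map (fun ω => (X ω s, X ω (s + t))) Set.univ = 1 := by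
      rw [Measure.map_apply ((hXs s).prodMk (hXs (s + t))) MeasurableSet.univ]; simp
    rw [hd s hs, withDensity_apply _ MeasurableSet.univ] at h1
    simpa using h1
  rw [integrable_prod_iff hp.aestronglyMeasurable]
  constructor
  · refine (ae_restrict_iff' measurableSet_Ioc).2 (Filter.Eventually.of_forall fun s hs => ?_)
    refine ⟨(hps s).aestronglyMeasurable, ?_⟩
    rw [hasFiniteIntegral_iff_ofReal (Filter.Eventually.of_forall fun z => hp0 _ _ _),
      hl s ⟨hs.1.le, hs.2⟩]
    simp
  · have : (fun s => ∫ z : ℝ × ℝ, ‖p s z.1 z.2‖) =ᵐ[volume.restrict (Set.Ioc t₀ T)]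
        fun _ => (1 : ℝ) := by
      refine (ae_restrict_iff' measurableSet_Ioc).2 (Filter.Eventually.of_forall fun s hs => ?_)
      simp_rw [Real.norm_of_nonneg (hp0 _ _ _)]
      rw [integral_eq_lintegral_of_nonneg_ae (Filter.Eventually.of_forall fun z => hp0 _ _ _)
        (hps s).aestronglyMeasurable, hl s ⟨hs.1.le, hs.2⟩]
      simp
    exact (integrable_congr this).2 (integrable_const _)

lemma law_int {Ω : Type*} [MeasurableSpace Ω] (P : Measure Ω) [IsProbabilityMeasure P]
    (X : Ω → ℝ → ℝ) (hX : Measurable (fun q : Ω × ℝ => X q.1 q.2)) (t₀ T t : ℝ) (htT : t₀ < T)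
    (p : ℝ → ℝ → ℝ → ℝ) (hp : Measurable (fun q : ℝ × ℝ × ℝ => p q.1 q.2.1 q.2.2))
    (hp0 : ∀ s x y, 0 ≤ p s x y)
    (hd : ∀ s ∈ Set.Icc t₀ T, P.map (fun ω => (X ω s, X ω (s + t))) =
        (volume : Measure (ℝ × ℝ)).withDensity (fun z => ENNReal.ofReal (p s z.1 z.2)))
    (F : ℝ × ℝ → ℝ) (hF : Measurable F) (M : ℝ) (hM : ∀ z, |F z| ≤ M) :
    ∫ ω, (T - t₀)⁻¹ * (∫ s in t₀..T, F (X ω s, X ω (s + t))) ∂P =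
      ∫ z : ℝ × ℝ, F z * ((T - t₀)⁻¹ * ∫ s in t₀..T, p s z.1 z.2) := by
  have hXs : ∀ s, Measurable fun ω => X ω s := fun s => hX.comp (measurable_id.prodMk measurable_const)
  have hps : ∀ s, Measurable fun z : ℝ × ℝ => p s z.1 z.2 := fun s =>
    hp.comp (measurable_const.prodMk measurable_id)
  have hj := dens_joint P X hX t₀ T t p hp hp0 hd
  simp_rw [intervalIntegral.integral_of_le htT.le]
  have hI1 : Integrable (Function.uncurry fun (ω : Ω) (s : ℝ) => F (X ω s, X ω (s + t)))
      (P.prod (volume.restrict (Set.Ioc t₀ T))) := by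
    refine Integrable.of_bound ?_ M (Filter.Eventually.of_forall fun q => hM _)
    refine (hF.comp (Measurable.prodMk hX ?_)).aestronglyMeasurable
    exact hX.comp (measurable_fst.prodMk (measurable_snd.add_const t))
  have hI2 : Integrable (Function.uncurry fun (s : ℝ) (z : ℝ × ℝ) => p s z.1 z.2 * F z)
      ((volume.restrict (Set.Ioc t₀ T)).prod volume) :=
    hj.mul_bdd (hF.comp measurable_snd).aestronglyMeasurable
      (Filter.Eventually.of_forall fun q => hM _)
  rw [integral_const_mul, integral_integral_swap hI1]
  have e : ∫ s in Set.Ioc t₀ T, ∫ ω, F (X ω s, X ω (s + t)) ∂P =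
      ∫ s in Set.Ioc t₀ T, ∫ z : ℝ × ℝ, p s z.1 z.2 * F z := by
    refine setIntegral_congr_fun measurableSet_Ioc fun s hs => ?_
    have hm := (hXs s).prodMk (hXs (s + t))
    rw [← integral_map (f := F) hm.aemeasurable hF.aestronglyMeasurable, hd s ⟨hs.1.le, hs.2⟩,
      integral_withDensity_eq_integral_toReal_smul (hps s).ennreal_ofReal
        (Filter.Eventually.of_forall fun _ => ENNReal.ofReal_lt_top)]
    simp_rw [ENNReal.toReal_ofReal (hp0 _ _ _), smul_eq_mul]
  rw [e, integral_integral_swap hI2, ← integral_const_mul]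
  congr 1; ext z
  rw [integral_mul_const]; ring

lemma jensen_path {t₀ T : ℝ} (htT : t₀ < T) (f : ℝ → ℝ) (hf : Measurable f) (M : ℝ)
    (hM : ∀ s, |f s| ≤ M) :
    ((T - t₀)⁻¹ * ∫ s in t₀..T, f s) ^ 2 ≤ (T - t₀)⁻¹ * ∫ s in t₀..T, f s ^ 2 := by
  have hτ : 0 < T - t₀ := sub_pos.2 htT
  rw [intervalIntegral.integral_of_le htT.le, intervalIntegral.integral_of_le htT.le]
  set μ := (volume : Measure ℝ).restrict (Set.Ioc t₀ T)
  have i1 : Integrable f μ := Integrable.of_bound hf.aestronglyMeasurable M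
    (Filter.Eventually.of_forall hM)
  have i2 : Integrable (fun s => f s ^ 2) μ :=
    Integrable.of_bound (hf.pow_const 2).aestronglyMeasurable (M ^ 2)
      (Filter.Eventually.of_forall fun ω => by
        rw [norm_pow]; exact pow_le_pow_left₀ (norm_nonneg _) (hM ω) 2)
  set I := (T - t₀)⁻¹ * ∫ s, f s ∂μ with hI
  have hI' : ∫ s, f s ∂μ = (T - t₀) * I := by rw [hI, mul_inv_cancel_left₀ hτ.ne']
  have := integral_comb3 i2 i1 (integrable_const (μ := μ) (1 : ℝ)) 1 (-(2 * I)) (I ^ 2)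
  have h0 : 0 ≤ ∫ s, (1 * f s ^ 2 + -(2 * I) * f s + I ^ 2 * 1) ∂μ :=
    integral_nonneg fun s => by
      have : 0 ≤ (f s - I) ^ 2 := sq_nonneg _
      simp only [Pi.zero_apply]
      nlinarith
  have hc : ∫ _, (1 : ℝ) ∂μ = T - t₀ := by
    simp [μ, measureReal_def, hτ.le]
  rw [this, hI', hc] at h0
  have h3 : (T - t₀) * I ^ 2 ≤ ∫ s, f s ^ 2 ∂μ := by nlinarith
  rw [inv_mul_eq_div, le_div_iff₀ hτ]
  linarith

lemma W_tail {Ω : Type*} [MeasurableSpace Ω] (P : Measure Ω) [IsProbabilityMeasure P]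
    (K : ℝ → ℝ) (hKmeas : Measurable K) (hKsym : ∀ x, K (-x) = K x)
    (hKint : Integrable K (volume : Measure ℝ)) (hKone : ∫ x, K x = 1)
    (t₀ T : ℝ) (ht₀ : 0 < t₀) (htT : t₀ < T)
    (X : ℕ → Ω → ℝ → ℝ)
    (hXmeas : ∀ i, Measurable (fun q : Ω × ℝ => X i q.1 q.2))
    (hXcont : ∀ i ω, ContinuousOn (X i ω) (Set.Icc 0 (2 * T)))
    (hindep : iIndepFun (m := fun _ : ℕ => (inferInstance : MeasurableSpace (ℝ → ℝ)))
      (fun i ω => X i ω) P)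
    (t : ℝ) (ht : t ∈ Set.Icc t₀ T)
    (p : ℝ → ℝ → ℝ → ℝ) (hp : Measurable (fun q : ℝ × ℝ × ℝ => p q.1 q.2.1 q.2.2))
    (hp0 : ∀ s x y, 0 ≤ p s x y)
    (hd : ∀ i, ∀ s ∈ Set.Icc t₀ T, P.map (fun ω => (X i ω s, X i ω (s + t))) =
        (volume : Measure (ℝ × ℝ)).withDensity (fun z => ENNReal.ofReal (p s z.1 z.2)))
    (st : ℝ × ℝ → ℝ) (hst : ∀ z, st z = (T - t₀)⁻¹ * ∫ s in t₀..T, p s z.1 z.2)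
    (c₁ : ℝ) (hc₁ : 0 < c₁) (hstbdd : ∀ z : ℝ × ℝ, |st z| ≤ c₁)
    (A κ : ℝ) (hA : A = (∫ x, |K x|) ^ 2)
    (hκ : κ = (c₁ * A ^ 2 + 2 * (A * (A * c₁ + c₁)))⁻¹) (N : ℕ) (hN : 0 < N)
    (θ : ℝ) (hθ : θ ∈ Set.Ioo (0 : ℝ) 1) (r : ℝ) (h l : ℝ × ℝ) (h1 : 0 < h.1) (h2 : 0 < h.2)
    (l1 : 0 < l.1) (l2 : 0 < l.2) :
    P.real {ω | θ * biasSq K st l + r / (κ * θ * N) ≤ |Wstat K t₀ T t st X N h l ω|}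
      ≤ 2 * exp (-r) := by
  have hN' : (0 : ℝ) < N := by exact_mod_cast hN
  have hτ : 0 < T - t₀ := sub_pos.2 htT
  have hA1 : 1 ≤ A := by
    have : (1 : ℝ) ≤ ∫ x, |K x| := by
      rw [← hKone]; exact integral_mono hKint hKint.abs fun x => le_abs_self _
    rw [hA]; nlinarith
  have hA0 : 0 < A := by linarith
  -- kernels
  obtain ⟨qhi, qhA⟩ := Qp_int hKint h1 h2
  obtain ⟨qli, qlA⟩ := Qp_int hKint l1 l2
  have qhm := Qp_meas hKmeas h
  have qlm := Qp_meas hKmeas l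
  rw [← hA] at qhA qlA
  -- target
  have hj := dens_joint P (X 0) (hXmeas 0) t₀ T t p hp hp0 (hd 0)
  have hste : st = fun z : ℝ × ℝ => (T - t₀)⁻¹ * ∫ s in Set.Ioc t₀ T, p s z.1 z.2 := by
    ext z; rw [hst, intervalIntegral.integral_of_le htT.le]
  have hsti : Integrable st := by
    rw [hste]; exact hj.integral_prod_right.const_mul _
  have hstm : Measurable st := by
    rw [hste]
    refine Measurable.const_mul ?_ _
    exact (StronglyMeasurable.integral_prod_left
      (f := fun (s : ℝ) (z : ℝ × ℝ) => p s z.1 z.2) hp.stronglyMeasurable).measurable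
  have hst2 : Integrable (fun z => st z ^ 2) := by
    have := hsti.mul_bdd hstm.aestronglyMeasurable (Filter.Eventually.of_forall hstbdd)
    simpa [sq] using this
  -- g
  set g : ℝ × ℝ → ℝ := fun z => cv (Qp K l) st z - st z with hg
  have hgm : Measurable g := (cv_meas qlm hstm).sub hstm
  have hgb : ∀ z, |g z| ≤ A * c₁ + c₁ := fun z => by
    refine (abs_sub _ _).trans (add_le_add ?_ (hstbdd z))
    rw [← qlA]; exact cv_bdd qli hstbdd z
  have hgi : Integrable g := (cv_int qli hsti).sub hsti
  have hg2 : Integrable (fun z => g z ^ 2) := by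
    have := hgi.mul_bdd hgm.aestronglyMeasurable (Filter.Eventually.of_forall hgb)
    simpa [sq] using this
  have hbias : biasSq K st l = ∫ z, g z ^ 2 := rfl
  have hbias0 : 0 ≤ biasSq K st l := by rw [hbias]; exact integral_nonneg fun z => sq_nonneg _
  -- G
  set G := cv (Qp K h) g with hG
  set B := A * (A * c₁ + c₁) with hB
  have hB0 : 0 < B := by positivity
  have hGm : Measurable G := cv_meas qhm hgm
  have hGb : ∀ z, |G z| ≤ B := fun z => by
    have := cv_bdd qhi hgb z
    rwa [qhA] at this
  obtain ⟨hG2, hG2le⟩ := cv_sq_int qhm qhi (by rw [qhA]; exact hA0) hgm hgb hg2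
  rw [qhA, ← hbias] at hG2le
  -- Y
  set Y : ℕ → Ω → ℝ := fun i ω => (T - t₀)⁻¹ * ∫ s in t₀..T, G (X i ω s, X i ω (s + t)) with hY
  have hXω : ∀ i ω, Measurable (X i ω) := fun i ω =>
    (hXmeas i).comp (measurable_const.prodMk measurable_id)
  have hYfac : ∀ i, ∃ F : (ℝ → ℝ) → ℝ, Measurable F ∧
      (fun ω => ∫ s in t₀..T, G (X i ω s, X i ω (s + t))) = F ∘ (X i) := fun i =>
    path_meas (X i) t₀ T t ht₀ htT ht (hXcont i) G hGm
  choose F hFm hF using hYfac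
  have hYF : Y = fun i => (fun φ => (T - t₀)⁻¹ * F i φ) ∘ (fun ω => X i ω) := by
    ext i ω
    have := congrFun (hF i) ω
    simp only [hY, Function.comp] at this ⊢
    rw [this]
  have hYind : iIndepFun Y P := by
    rw [hYF]
    exact hindep.comp (fun i φ => (T - t₀)⁻¹ * F i φ) (fun i => (hFm i).const_mul _)
  have hYm : ∀ i, Measurable (Y i) := fun i => by
    rw [hYF]
    refine ((hFm i).const_mul _).comp (measurable_pi_iff.2 fun s => ?_)
    exact (hXmeas i).comp (measurable_id.prodMk measurable_const)
  have hpm : ∀ i ω, Measurable fun s => (X i ω s, X i ω (s + t)) := fun i ω =>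
    (hXω i ω).prodMk ((hXω i ω).comp (measurable_id.add_const t))
  have hYb : ∀ i ω, |Y i ω| ≤ B := fun i ω => by
    have := intervalIntegral.norm_integral_le_of_norm_le_const (a := t₀) (b := T)
      (f := fun s => G (X i ω s, X i ω (s + t))) (C := B) fun s _ => hGb _
    rw [Real.norm_eq_abs, abs_of_pos hτ] at this
    simp only [hY]
    rw [abs_mul, abs_of_pos (inv_pos.2 hτ), inv_mul_le_iff₀ hτ]
    linarith
  have hYE : ∀ i, ∫ ω, Y i ω ∂P = ∫ z, G z * st z := fun i => by
    simp only [hY, hst]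
    exact law_int P (X i) (hXmeas i) t₀ T t htT p hp hp0 (hd i) G hGm B hGb
  have hG2b : ∀ z, |G z ^ 2| ≤ B ^ 2 := fun z => by
    rw [abs_pow]; exact pow_le_pow_left₀ (abs_nonneg _) (hGb z) 2
  have hY2 : ∀ i, ∫ ω, Y i ω ^ 2 ∂P ≤ c₁ * A ^ 2 * biasSq K st l := fun i => by
    have hlaw := law_int P (X i) (hXmeas i) t₀ T t htT p hp hp0 (hd i) (fun z => G z ^ 2)
      (hGm.pow_const 2) (B ^ 2) hG2b
    simp only [← hst] at hlaw
    have hj1 : ∫ ω, Y i ω ^ 2 ∂P ≤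
        ∫ ω, (T - t₀)⁻¹ * (∫ s in t₀..T, G (X i ω s, X i ω (s + t)) ^ 2) ∂P := by
      refine integral_mono_of_nonneg (Filter.Eventually.of_forall fun ω => sq_nonneg _) ?_
        (Filter.Eventually.of_forall fun ω =>
          jensen_path htT _ (hGm.comp (hpm i ω)) B fun s => hGb _)
      have hI1 : Integrable (fun q : Ω × ℝ => G (X i q.1 q.2, X i q.1 (q.2 + t)) ^ 2)
          (P.prod (volume.restrict (Set.Ioc t₀ T))) := by
        refine Integrable.of_bound ?_ (B ^ 2) (Filter.Eventually.of_forall fun q => hG2b _)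
        refine ((hGm.comp (Measurable.prodMk (hXmeas i) ?_)).pow_const 2).aestronglyMeasurable
        exact (hXmeas i).comp (measurable_fst.prodMk (measurable_snd.add_const t))
      simp_rw [intervalIntegral.integral_of_le htT.le]
      exact hI1.integral_prod_left.const_mul _
    rw [hlaw] at hj1
    have hj2 : ∫ z, G z ^ 2 * st z ≤ ∫ z, c₁ * G z ^ 2 := by
      refine integral_mono (hG2.mul_bdd hstm.aestronglyMeasurable
        (Filter.Eventually.of_forall hstbdd)) (hG2.const_mul _) fun z => ?_
      have := (le_abs_self _).trans (hstbdd z)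
      have h3 := sq_nonneg (G z)
      show G z ^ 2 * st z ≤ c₁ * G z ^ 2
      nlinarith
    rw [integral_const_mul] at hj2
    calc _ ≤ _ := hj1
      _ ≤ _ := hj2
      _ ≤ c₁ * (A ^ 2 * biasSq K st l) := mul_le_mul_of_nonneg_left hG2le hc₁.le
      _ = _ := by ring
  -- W
  have hW : ∀ ω, Wstat K t₀ T t st X N h l ω =
      (N : ℝ)⁻¹ * ∑ i ∈ Finset.range N, Y i ω - ∫ z, G z * st z := by
    intro ω
    have hPhi : ∀ i, Integrable (fun z => PhiMap K t₀ T t h.1 h.2 (X i ω) z) ∧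
        ∫ z, PhiMap K t₀ T t h.1 h.2 (X i ω) z * g z = Y i ω := by
      intro i
      obtain ⟨a, b⟩ := path_fubini qhm qhi hgm hgb (volume.restrict (Set.Ioc t₀ T)) _ (hpm i ω)
      have e : (fun z => PhiMap K t₀ T t h.1 h.2 (X i ω) z) = fun z => (T - t₀)⁻¹ *
          ∫ s in Set.Ioc t₀ T, Qp K h ((X i ω s, X i ω (s + t)) - z) := by
        ext z
        rw [PhiMap, intervalIntegral.integral_of_le htT.le]
        rfl
      constructor
      · rw [e]; exact a.const_mul _
      · have e' := fun z => congrFun e z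
        simp_rw [e', mul_assoc, integral_const_mul]
        rw [b]
        simp only [hY]
        rw [intervalIntegral.integral_of_le htT.le]
    have hPg : ∀ i, Integrable (fun z => PhiMap K t₀ T t h.1 h.2 (X i ω) z * g z) := fun i =>
      (hPhi i).1.mul_bdd hgm.aestronglyMeasurable (Filter.Eventually.of_forall hgb)
    have hcg : Integrable (fun z => cv (Qp K h) st z * g z) :=
      (cv_int qhi hsti).mul_bdd hgm.aestronglyMeasurable (Filter.Eventually.of_forall hgb)
    have hSg : Integrable (fun z => (N : ℝ)⁻¹ *
        ∑ i ∈ Finset.range N, PhiMap K t₀ T t h.1 h.2 (X i ω) z * g z) :=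
      (integrable_finsetSum _ fun i _ => hPg i).const_mul _
    have e1 : Wstat K t₀ T t st X N h l ω = ∫ z, ((N : ℝ)⁻¹ *
        ∑ i ∈ Finset.range N, PhiMap K t₀ T t h.1 h.2 (X i ω) z * g z
          - cv (Qp K h) st z * g z) := by
      unfold Wstat
      congr 1; ext z
      rw [← Finset.sum_mul, ← mul_assoc, ← sub_mul]
      rfl
    rw [e1, integral_sub hSg hcg, integral_const_mul, integral_finsetSum _ fun i _ => hPg i,
      cv_dual qhi (Qp_even hKsym h) hsti hgm hgb]
    rw [Finset.sum_congr rfl fun i _ => (hPhi i).2]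
  have hD : 0 < c₁ * A ^ 2 + 2 * B := by positivity
  have hκ0 : 0 < κ := by rw [hκ]; positivity
  have hκD : κ * (c₁ * A ^ 2 + 2 * B) = 1 := by rw [hκ, inv_mul_cancel₀ hD.ne']
  have hκB : κ * (2 * B) ≤ 1 := by
    have : 0 ≤ κ * (c₁ * A ^ 2) := by positivity
    linarith
  have hκA : κ * (c₁ * A ^ 2) ≤ 1 := by
    have : 0 ≤ κ * (2 * B) := by positivity
    linarith
  have hu0 : 0 < κ * θ := mul_pos hκ0 hθ.1
  have := bern P Y hYm hYind (∫ z, G z * st z) B (c₁ * A ^ 2 * biasSq K st l) (κ * θ)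
    (θ * biasSq K st l + r / (κ * θ * N)) r hYb hYE hY2 hu0 (by
      have := mul_le_mul_of_nonneg_right hκB hθ.1.le
      have := hθ.2
      linarith) N hN (by
      have := mul_le_mul_of_nonneg_right hκA (mul_nonneg hθ.1.le hbias0)
      linarith)
  simp_rw [hW]
  exact this
/-- Lemma A.5: concentration of the cross terms `W_{𝐡,𝐡₀}`,
`W_{𝐡₀,𝐡}` and `W_{𝐡,𝐡}`, uniformly over `𝐡 ∈ H_N²`, with probability at least
`1 − 2|H_N|²e^{−λ}`. -/
theorem control_W_term
    {Ω : Type*} [MeasurableSpace Ω] (P : Measure Ω) [IsProbabilityMeasure P]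
    (K : ℝ → ℝ) (hKmeas : Measurable K)
    (hKsq : MemLp K 2 (volume : Measure ℝ))
    (hKsym : ∀ x, K (-x) = K x)
    (hKint : Integrable K (volume : Measure ℝ)) (hKone : ∫ x, K x = 1)
    (t₀ T : ℝ) (ht₀ : 0 < t₀) (htT : t₀ < T)
    (X : ℕ → Ω → ℝ → ℝ)
    (hXmeas : ∀ i, Measurable (fun q : Ω × ℝ => X i q.1 q.2))
    (hXcont : ∀ i ω, ContinuousOn (X i ω) (Set.Icc 0 (2 * T)))
    (hindep : iIndepFun (m := fun _ : ℕ => (inferInstance : MeasurableSpace (ℝ → ℝ)))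
      (fun i ω => X i ω) P)
    (hident : ∀ i j, IdentDistrib (fun ω => X i ω) (fun ω => X j ω) P P)
    (pst : ℝ → ℝ → ℝ → ℝ → ℝ)
    (hpstmeas : ∀ t ∈ Set.Icc t₀ T,
      Measurable (fun q : ℝ × ℝ × ℝ => pst t q.1 q.2.1 q.2.2))
    (hpstpos : ∀ t s ξ ζ, 0 ≤ pst t s ξ ζ)
    (hdensity : ∀ t ∈ Set.Icc t₀ T, ∀ i, ∀ s ∈ Set.Icc t₀ T,
      P.map (fun ω => (X i ω s, X i ω (s + t))) =
        (volume : Measure (ℝ × ℝ)).withDensity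
          (fun z => ENNReal.ofReal (pst t s z.1 z.2)))
    (st : ℝ → ℝ × ℝ → ℝ)
    (hst : ∀ t z, st t z = (T - t₀)⁻¹ * ∫ s in t₀..T, pst t s z.1 z.2)
    (c₁ : ℝ) (hc₁ : 0 < c₁)
    (hstbdd : ∀ t ∈ Set.Icc t₀ T, ∀ z : ℝ × ℝ, |st t z| ≤ c₁)
    (hstL2 : ∀ t ∈ Set.Icc t₀ T, MemLp (st t) 2 (volume : Measure (ℝ × ℝ))) :
    ∃ c > (0 : ℝ), ∀ N : ℕ, 0 < N → ∀ h₀ : ℝ, 0 < h₀ → 1 ≤ (N : ℝ) * h₀ →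
      ∀ H_N : Finset ℝ, (∀ h ∈ H_N, h ∈ Set.Icc h₀ 1) →
      ∀ t ∈ Set.Icc t₀ T, ∀ θ ∈ Set.Ioo (0 : ℝ) 1, ∀ lam > (0 : ℝ),
      1 - 2 * (H_N.card : ℝ) ^ 2 * exp (-lam) ≤
        (P {ω | ∀ bh ∈ H_N ×ˢ H_N,
          |Wstat K t₀ T t (st t) X N bh (h₀, h₀) ω|
              - θ * biasSq K (st t) (h₀, h₀)
            ≤ c * (1 + lam) ^ 2 / (θ * N)
          ∧ |Wstat K t₀ T t (st t) X N (h₀, h₀) bh ω|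
              - θ * biasSq K (st t) bh
            ≤ c * (1 + lam) ^ 2 / (θ * N)
          ∧ |Wstat K t₀ T t (st t) X N bh bh ω|
              - θ * biasSq K (st t) bh
            ≤ c * (1 + lam) ^ 2 / (θ * N)}).toReal := by
  obtain ⟨A, hA⟩ : ∃ A : ℝ, A = (∫ x, |K x|) ^ 2 := ⟨_, rfl⟩
  obtain ⟨κ, hκ⟩ : ∃ κ : ℝ, κ = (c₁ * A ^ 2 + 2 * (A * (A * c₁ + c₁)))⁻¹ := ⟨_, rfl⟩
  have hA1 : 1 ≤ A := by
    have : (1 : ℝ) ≤ ∫ x, |K x| := by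
      rw [← hKone]; exact integral_mono hKint hKint.abs fun x => le_abs_self _
    rw [hA]; nlinarith
  have hA0 : 0 < A := by linarith
  have hκ0 : 0 < κ := by rw [hκ]; positivity
  refine ⟨3 / κ, by positivity, ?_⟩
  intro N hN h₀ hh₀ _ H hH t ht θ hθ lam hlam
  have hN' : (0 : ℝ) < N := by exact_mod_cast hN
  have hθ0 := hθ.1
  set R := 3 / κ * (1 + lam) ^ 2 / (θ * N) with hR
  have hlog : Real.log 3 ≤ 2 := by
    have := Real.log_le_sub_one_of_pos (show (0 : ℝ) < 3 by norm_num)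
    linarith
  have hr : (lam + Real.log 3) / (κ * θ * N) ≤ R := by
    have : R = (3 * (1 + lam) ^ 2) / (κ * θ * N) := by
      rw [hR]; field_simp
    rw [this]
    gcongr
    nlinarith
  have hexp : exp (-(lam + Real.log 3)) = exp (-lam) / 3 := by
    rw [neg_add, exp_add, exp_neg (Real.log 3), Real.exp_log (by norm_num)]; rfl
  have tail : ∀ h l : ℝ × ℝ, 0 < h.1 → 0 < h.2 → 0 < l.1 → 0 < l.2 →
      P.real {ω | R < |Wstat K t₀ T t (st t) X N h l ω| - θ * biasSq K (st t) l}
        ≤ 2 * (exp (-lam) / 3) := by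
    intro h l h1 h2 l1 l2
    rw [← hexp]
    refine le_trans (measureReal_mono ?_) (W_tail P K hKmeas hKsym hKint hKone t₀ T ht₀ htT X hXmeas
      hXcont hindep t ht (pst t) (hpstmeas t ht) (hpstpos t) (hdensity t ht) (st t) (hst t) c₁ hc₁
      (hstbdd t ht) A κ hA hκ N hN θ hθ (lam + Real.log 3) h l h1 h2 l1 l2)
    intro ω hω
    simp only [Set.mem_ofPred_eq] at hω ⊢
    linarith
  set S : Set Ω := {ω | ∀ bh ∈ H ×ˢ H,
          |Wstat K t₀ T t (st t) X N bh (h₀, h₀) ω|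
              - θ * biasSq K (st t) (h₀, h₀) ≤ R
          ∧ |Wstat K t₀ T t (st t) X N (h₀, h₀) bh ω|
              - θ * biasSq K (st t) bh ≤ R
          ∧ |Wstat K t₀ T t (st t) X N bh bh ω|
              - θ * biasSq K (st t) bh ≤ R} with hS
  let D : (ℝ × ℝ) → (ℝ × ℝ) → Set Ω := fun h l =>
    {ω | R < |Wstat K t₀ T t (st t) X N h l ω| - θ * biasSq K (st t) l}
  have hsub : Sᶜ ⊆ ⋃ bh ∈ H ×ˢ H, (D bh (h₀, h₀) ∪ (D (h₀, h₀) bh ∪ D bh bh)) := by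
    intro ω hω
    by_contra hcon
    apply hω
    simp only [Set.mem_iUnion, Set.mem_union, not_exists, not_or] at hcon
    intro bh hbh
    obtain ⟨a, b, c⟩ := hcon bh hbh
    exact ⟨not_lt.1 a, not_lt.1 b, not_lt.1 c⟩
  have hcomp : P.real Sᶜ ≤ 2 * (H.card : ℝ) ^ 2 * exp (-lam) := by
    calc P.real Sᶜ ≤ _ := measureReal_mono hsub (measure_ne_top _ _)
      _ ≤ ∑ bh ∈ H ×ˢ H, P.real (D bh (h₀, h₀) ∪ (D (h₀, h₀) bh ∪ D bh bh)) :=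
          measureReal_biUnion_finset_le _ _
      _ ≤ ∑ bh ∈ H ×ˢ H, 2 * exp (-lam) := by
          refine Finset.sum_le_sum fun bh hbh => ?_
          rw [Finset.mem_product] at hbh
          have p1 : 0 < bh.1 := hh₀.trans_le (hH _ hbh.1).1
          have p2 : 0 < bh.2 := hh₀.trans_le (hH _ hbh.2).1
          have u1 := measureReal_union_le (μ := P) (D bh (h₀, h₀)) (D (h₀, h₀) bh ∪ D bh bh)
          have u2 := measureReal_union_le (μ := P) (D (h₀, h₀) bh) (D bh bh)
          have t1 := tail bh (h₀, h₀) p1 p2 hh₀ hh₀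
          have t2 := tail (h₀, h₀) bh hh₀ hh₀ p1 p2
          have t3 := tail bh bh p1 p2 p1 p2
          simp only [D] at u1 u2 ⊢
          linarith
      _ = _ := by
          rw [Finset.sum_const, Finset.card_product, nsmul_eq_mul]; push_cast; ring
  have htot : (1 : ℝ) ≤ P.real S + P.real Sᶜ := by
    have := measureReal_union_le (μ := P) S Sᶜ
    rw [Set.union_compl_self] at this
    simpa using this
  have : P.real S = (P S).toReal := rfl
  rw [← this]
  linarith
end
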